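/- Fix an integer ℓ ≥ 2 and a computable function f of ℓ string arguments. There exists a constant d (depending only on ℓ, f and the universal machine) such that for every ℓ-party nondeterministic communication protocol Π = (𝓡, t) over D = {0,1}^{n₁} × ⋯ × {0,1}^{n_ℓ} that computes f, and every (x₁,…,x_ℓ) ∈ D: C(t̃ ∣ Π) ≥ (1/(ℓ−1))·( Σ_{i=1}^{ℓ} C(f̃ ∣ x_i, Π) + Σ_{i=1}^{ℓ} C(t̃ ∣ x_i, f̃, Π) − log₂ ρ(t̃) ) − d·log₂ n − d, where t̃ = t(x₁,…,x_ℓ), f̃ = f(x₁,…,x_ℓ), and n = max(n₁,…,n_ℓ). -/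

import Mathlib

/-- A machine maps a program and a condition string to at most one output string. -/
abbrev Machine := List Bool → List Bool →. List Bool

/-- Conditional Kolmogorov complexity relative to machine `U`. -/
noncomputable def KC (U : Machine) (x u : List Bool) : ℕ :=
  sInf { k | ∃ p : List Bool, p.length = k ∧ x ∈ U p u }

/-- `U` is a universal machine. -/
def IsUniversal (U : Machine) : Prop :=
  Partrec₂ U ∧
    ∀ V : Machine, Partrec₂ V →
      ∃ c : ℕ, ∀ p u x, x ∈ V p u → ∃ q : List Bool, x ∈ U q u ∧ q.length ≤ p.length + c

/-- Self-delimiting encoding of a string. -/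
def eBits (x : List Bool) : List Bool := (x.map fun b => [b, b]).flatten ++ [true, false]

/-- The fixed computable pairing of strings. -/
def ePair (x y : List Bool) : List Bool := eBits x ++ y

/-- Encoding of a list of strings. -/
def eList (l : List (List Bool)) : List Bool := (l.map eBits).flatten

/-- Conditional mutual information `I(x : y ∣ u)`. -/
noncomputable def MI (U : Machine) (x y u : List Bool) : ℝ :=
  (KC U x u : ℝ) + KC U y u - KC U (ePair x y) u

/-- Conditional triple information `I(x : y : w ∣ u)`. -/
noncomputable def TI (U : Machine) (x y w u : List Bool) : ℝ :=
  (KC U x u : ℝ) + KC U y u + KC U w u - KC U (ePair x y) u - KC U (ePair x w) u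
    - KC U (ePair y w) u + KC U (ePair x (ePair y w)) u

/-- A combinatorial rectangle, given by its list of rows and list of columns. -/
structure Rect where
  rows : List (List Bool)
  cols : List (List Bool)
deriving DecidableEq

/-- Canonical encoding of a rectangle. -/
def encRect (R : Rect) : List Bool := ePair (eList R.rows) (eList R.cols)

/-- The list of all bit strings of length `n`. -/
def allBV : ℕ → List (List Bool)
  | 0 => [[]]
  | n + 1 => (allBV n).flatMap fun x => [false :: x, true :: x]

/-- A nondeterministic communication protocol over `{0,1}^{n₁} × {0,1}^{n₂}`:
a finite family of rectangles covering the domain together with a transcript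
function selecting, for every cell of the domain, a rectangle containing it. -/
structure Protocol (n₁ n₂ : ℕ) where
  rects : List Rect
  trans : List Bool → List Bool → Rect
  rows_len : ∀ R ∈ rects, ∀ s ∈ R.rows, s.length = n₁
  cols_len : ∀ R ∈ rects, ∀ s ∈ R.cols, s.length = n₂
  trans_mem : ∀ x y : List Bool, x.length = n₁ → y.length = n₂ → trans x y ∈ rects
  trans_row : ∀ x y : List Bool, x.length = n₁ → y.length = n₂ → x ∈ (trans x y).rows
  trans_col : ∀ x y : List Bool, x.length = n₁ → y.length = n₂ → y ∈ (trans x y).cols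

/-- The thickness of a cell: the number of rectangles of the protocol containing it. -/
def cellThick {n₁ n₂ : ℕ} (P : Protocol n₁ n₂) (x y : List Bool) : ℕ :=
  P.rects.countP fun R => decide (x ∈ R.rows ∧ y ∈ R.cols)

/-- The thickness of a rectangle: the maximal thickness of a cell of the rectangle. -/
def rectThick {n₁ n₂ : ℕ} (P : Protocol n₁ n₂) (R : Rect) : ℕ :=
  (R.rows.flatMap fun x => R.cols.map fun y => cellThick P x y).foldr max 0

/-- Canonical encoding of a protocol: the list of its rectangles followed by
the graph of the transcript function on the domain. -/
def encProt {n₁ n₂ : ℕ} (P : Protocol n₁ n₂) : List Bool :=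
  ePair (eList (P.rects.map encRect))
    (eList ((allBV n₁).flatMap fun x => (allBV n₂).map fun y => encRect (P.trans x y)))

/-- Canonical encoding of an `ℓ`-dimensional rectangle `S₁ × ⋯ × S_ℓ`. -/
def encRectL {ℓ : ℕ} (R : Fin ℓ → List (List Bool)) : List Bool :=
  eList ((List.finRange ℓ).map fun i => eList (R i))

/-- An `ℓ`-party nondeterministic communication protocol over
`{0,1}^{nn 0} × ⋯ × {0,1}^{nn (ℓ-1)}`. -/
structure MProtocol (ℓ : ℕ) (nn : Fin ℓ → ℕ) where
  rects : List (Fin ℓ → List (List Bool))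
  trans : (Fin ℓ → List Bool) → (Fin ℓ → List (List Bool))
  sides_len : ∀ R ∈ rects, ∀ i : Fin ℓ, ∀ s ∈ R i, s.length = nn i
  trans_mem : ∀ x : Fin ℓ → List Bool, (∀ i, (x i).length = nn i) → trans x ∈ rects
  trans_contains : ∀ x : Fin ℓ → List Bool, (∀ i, (x i).length = nn i) → ∀ i, x i ∈ trans x i

/-- The thickness of a cell: the number of rectangles of the protocol containing it. -/
def cellThickL {ℓ : ℕ} {nn : Fin ℓ → ℕ} (P : MProtocol ℓ nn) (x : Fin ℓ → List Bool) : ℕ :=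
  P.rects.countP fun R => decide (∀ i, x i ∈ R i)

/-- The thickness of a rectangle: the maximal thickness of a cell of the rectangle. -/
def rectThickL {ℓ : ℕ} {nn : Fin ℓ → ℕ} (P : MProtocol ℓ nn)
    (R : Fin ℓ → List (List Bool)) : ℕ :=
  (Fintype.piFinset fun i => (R i).toFinset).sup (cellThickL P)

/-- Canonical encoding of an `ℓ`-party protocol. -/
noncomputable def encMProt {ℓ : ℕ} {nn : Fin ℓ → ℕ} (P : MProtocol ℓ nn) : List Bool :=
  ePair (eList (P.rects.map encRectL))
    (eList (((Fintype.piFinset fun i : Fin ℓ => (allBV (nn i)).toFinset).toList).map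
      fun x => encRectL (P.trans x)))

/-! ### Primitive recursiveness through `fun_prop` -/

section PrimrecRules

variable {α β γ : Type*} [Primcodable α] [Primcodable β] [Primcodable γ]

theorem Primrec.fst_apply {f : α → β × γ} (hf : Primrec f) : Primrec fun a => (f a).1 :=
  Primrec.fst.comp hf

theorem Primrec.snd_apply {f : α → β × γ} (hf : Primrec f) : Primrec fun a => (f a).2 :=
  Primrec.snd.comp hf

theorem Primrec.append_apply {f g : α → List β} (hf : Primrec f) (hg : Primrec g) :
    Primrec fun a => f a ++ g a :=
  Primrec.list_append.comp hf hg

theorem Primrec.length_apply {f : α → List β} (hf : Primrec f) :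
    Primrec fun a => (f a).length :=
  Primrec.list_length.comp hf

theorem Primrec.getD_apply {f : α → List β} {i : α → ℕ} (d : β) (hf : Primrec f)
    (hi : Primrec i) : Primrec fun a => (f a).getD (i a) d :=
  (Primrec.list_getD d).comp hf hi

theorem Primrec.two_pow_apply {f : α → ℕ} (hf : Primrec f) : Primrec fun a => 2 ^ f a := by
  have h : Primrec fun n : ℕ => 2 ^ n :=
    (Primrec.nat_rec' (g := fun _ => 1) (h := fun _ p => p.2 * 2) Primrec.id (Primrec.const 1)
      (Primrec.nat_mul.comp (Primrec.snd.comp Primrec.snd) (Primrec.const 2))).of_eq fun n => by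
        induction n with
        | zero => rfl
        | succ n ih => simp only [id_eq] at ih ⊢; rw [ih, pow_succ]
  exact h.comp hf

end PrimrecRules

attribute [fun_prop] Primrec
attribute [fun_prop] Primrec.id Primrec.const Primrec.comp Primrec.pair
attribute [fun_prop] Primrec.fst_apply Primrec.snd_apply Primrec.append_apply
  Primrec.length_apply Primrec.getD_apply Primrec.two_pow_apply

/-! ### Semidecidable predicates -/

/-- A predicate is semidecidable if it is the union of an increasing sequence of predicates that
are uniformly primitive recursive. -/
def Semidec {α : Type*} [Primcodable α] (p : α → Prop) : Prop :=
  ∃ q : α → ℕ → Bool, Primrec₂ q ∧ (∀ a s s', s ≤ s' → q a s = true → q a s' = true) ∧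
    ∀ a, p a ↔ ∃ s, q a s = true

namespace Semidec

variable {α β σ : Type*} [Primcodable α] [Primcodable β] [Primcodable σ]

theorem of_eq {p q : α → Prop} (hp : Semidec p) (h : ∀ a, p a ↔ q a) : Semidec q := by
  obtain ⟨r, h1, h2, h3⟩ := hp
  exact ⟨r, h1, h2, fun a => (h a).symm.trans (h3 a)⟩

theorem comp {p : β → Prop} {f : α → β} (hp : Semidec p) (hf : Primrec f) :
    Semidec fun a => p (f a) := by
  obtain ⟨r, h1, h2, h3⟩ := hp
  exact ⟨fun a s => r (f a) s, h1.comp (hf.comp Primrec.fst) Primrec.snd, fun a => h2 (f a),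
    fun a => h3 (f a)⟩

theorem of_primrecPred {p : α → Prop} (hp : PrimrecPred p) : Semidec p := by
  obtain ⟨_, h⟩ := hp
  exact ⟨fun a _ => decide (p a), h.comp Primrec.fst, fun _ _ _ _ h => h, fun a => by simp⟩

theorem of_partrec {f : α →. σ} (hf : Partrec f) : Semidec fun t : α × σ => t.2 ∈ f t.1 := by
  obtain ⟨c, hc⟩ := Nat.Partrec.Code.exists_code.1 hf
  refine ⟨fun t s => decide (Nat.Partrec.Code.evaln s c (Encodable.encode t.1)
      = some (Encodable.encode t.2)), ?_, ?_, ?_⟩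
  · refine PrimrecPred.decide (Primrec.eq.comp ?_ ?_)
    · exact Nat.Partrec.Code.primrec_evaln.comp
        ((Primrec.snd.pair (Primrec.const c)).pair (Primrec.encode.comp
          (Primrec.fst.comp Primrec.fst)))
    · exact Primrec.option_some.comp (Primrec.encode.comp (Primrec.snd.comp Primrec.fst))
  · intro t s s' hs h
    simp only [decide_eq_true_eq] at h ⊢
    exact Nat.Partrec.Code.evaln_mono hs h
  · rintro ⟨a, b⟩
    have h := @Nat.Partrec.Code.evaln_complete c (Encodable.encode a) (Encodable.encode b)
    simp only [decide_eq_true_eq]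
    simp only [Option.mem_def] at h
    rw [← h, hc]
    simp

theorem and {p q : α → Prop} (hp : Semidec p) (hq : Semidec q) :
    Semidec fun a => p a ∧ q a := by
  obtain ⟨r, h1, h2, h3⟩ := hp
  obtain ⟨r', h1', h2', h3'⟩ := hq
  refine ⟨fun a s => r a s && r' a s, Primrec.and.comp h1 h1', ?_, ?_⟩
  · intro a s s' hs h
    simp only [Bool.and_eq_true] at h ⊢
    exact ⟨h2 _ _ _ hs h.1, h2' _ _ _ hs h.2⟩
  · intro a
    beta_reduce
    rw [h3, h3']
    constructor
    · rintro ⟨⟨s, hs⟩, s', hs'⟩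
      exact ⟨max s s', by
        rw [h2 _ _ _ (le_max_left _ _) hs, h2' _ _ _ (le_max_right _ _) hs']; rfl⟩
    · rintro ⟨s, hs⟩
      simp only [Bool.and_eq_true] at hs
      exact ⟨⟨s, hs.1⟩, s, hs.2⟩

theorem ex {p : α → β → Prop} (hp : Semidec fun t : α × β => p t.1 t.2) :
    Semidec fun a => ∃ b, p a b := by
  obtain ⟨r, h1, h2, h3⟩ := hp
  refine ⟨fun a s => decide (∃ n ∈ List.range s,
    ((Encodable.decode n : Option β).map fun b => r (a, b) s) = some true), ?_, ?_, ?_⟩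
  · refine PrimrecPred.decide ?_
    have hR : PrimrecRel fun (n : ℕ) (t : α × ℕ) =>
        ((Encodable.decode n : Option β).map fun b => r (t.1, b) t.2) = some true := by
      refine Primrec.eq.comp ?_ (Primrec.const _)
      refine Primrec.option_map (Primrec.decode.comp Primrec.fst) ?_
      refine Primrec₂.comp h1 ?_ ?_ <;> fun_prop
    exact hR.exists_mem_list.comp (Primrec.list_range.comp Primrec.snd) Primrec.id
  · intro a s s' hs h
    simp only [decide_eq_true_eq, List.mem_range, Option.map_eq_some_iff] at h ⊢
    obtain ⟨n, hn, b, hb, hr⟩ := h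
    exact ⟨n, hn.trans_le hs, b, hb, h2 _ _ _ hs hr⟩
  · intro a
    simp only [decide_eq_true_eq, List.mem_range, Option.map_eq_some_iff]
    constructor
    · rintro ⟨b, hb⟩
      obtain ⟨s, hs⟩ := (h3 (a, b)).1 hb
      exact ⟨max s (Encodable.encode b + 1), Encodable.encode b, by omega, b, Encodable.encodek b,
        h2 _ _ _ (le_max_left _ _) hs⟩
    · rintro ⟨s, n, -, b, -, hr⟩
      exact ⟨b, (h3 (a, b)).2 ⟨s, hr⟩⟩

theorem forall_mem {p : α → β → Prop} {l : α → List β}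
    (hp : Semidec fun t : α × β => p t.1 t.2) (hl : Primrec l) :
    Semidec fun a => ∀ b ∈ l a, p a b := by
  obtain ⟨r, h1, h2, h3⟩ := hp
  refine ⟨fun a s => decide (∀ b ∈ l a, r (a, b) s = true), ?_, ?_, ?_⟩
  · refine PrimrecPred.decide ?_
    have hR : PrimrecRel fun (b : β) (t : α × ℕ) => r (t.1, b) t.2 = true := by
      refine Primrec.eq.comp ?_ (Primrec.const _)
      refine Primrec₂.comp h1 ?_ ?_ <;> fun_prop
    exact hR.forall_mem_list.comp (hl.comp Primrec.fst) Primrec.id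
  · intro a s s' hs h
    simp only [decide_eq_true_eq] at h ⊢
    exact fun b hb => h2 _ _ _ hs (h b hb)
  · intro a
    simp only [decide_eq_true_eq]
    constructor
    · intro h
      generalize l a = L at h
      induction L with
      | nil => exact ⟨0, by simp⟩
      | cons b L ih =>
        obtain ⟨s, hs⟩ := ih fun b hb => h b (List.mem_cons_of_mem _ hb)
        obtain ⟨s', hs'⟩ := (h3 (a, b)).1 (h b List.mem_cons_self)
        refine ⟨max s s', fun b' hb' => ?_⟩
        rcases List.mem_cons.1 hb' with rfl | hb'
        · exact h2 _ _ _ (le_max_right _ _) hs'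
        · exact h2 _ _ _ (le_max_left _ _) (hs b' hb')
    · rintro ⟨s, hs⟩ b hb
      exact (h3 (a, b)).2 ⟨s, hs b hb⟩

theorem eq {f g : α → β} (hf : Primrec f) (hg : Primrec g) : Semidec fun a => f a = g a :=
  of_primrecPred (Primrec.eq.comp hf hg)

theorem le {f g : α → ℕ} (hf : Primrec f) (hg : Primrec g) : Semidec fun a => f a ≤ g a :=
  of_primrecPred (Primrec.nat_le.comp hf hg)

theorem _root_.PrimrecRel.mem_list : PrimrecRel fun (a : β) (l : List β) => a ∈ l :=
  ((Primrec.eq (α := β)).exists_mem_list.comp Primrec.snd Primrec.fst).of_eq fun t => by simp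

theorem mem {f : α → β} {l : α → List β} (hf : Primrec f) (hl : Primrec l) :
    Semidec fun a => f a ∈ l a :=
  of_primrecPred (PrimrecRel.mem_list.comp hf hl)

theorem nodup {l : α → List β} (hl : Primrec l) : Semidec fun a => (l a).Nodup := by
  classical
  have h : Primrec fun L : List β => decide L.Nodup := by
    refine (Primrec.list_rec (g := fun _ => true) (h := fun _ t => !decide (t.1 ∈ t.2.1) && t.2.2)
      Primrec.id (Primrec.const _) ?_).of_eq fun L => ?_
    · refine Primrec.and.comp (Primrec.not.comp (PrimrecPred.decide
        (PrimrecRel.mem_list.comp ?_ ?_))) ?_ <;> fun_prop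
    · induction L with
      | nil => simp
      | cons b L ih => simp only [id_eq] at ih ⊢; rw [ih]; simp [List.nodup_cons]
  exact of_primrecPred ⟨fun a => inferInstance, h.comp hl |>.of_eq fun a => by congr⟩

end Semidec

/-! ### Enumerating semidecidable sets -/

section Enumeration

variable {σ : Type*} [Primcodable σ] [DecidableEq σ]

/-- The first `n` steps of the enumeration without repetition of `{x | ∃ s, r x s}`. -/
def enumUpTo (r : σ → ℕ → Bool) : ℕ → List σ
  | 0 => []
  | n + 1 => ((Encodable.decode n : Option (σ × ℕ))).casesOn (enumUpTo r n) fun t =>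
      if r t.1 t.2 = true ∧ t.1 ∉ enumUpTo r n then enumUpTo r n ++ [t.1] else enumUpTo r n

theorem enumUpTo_succ_prefix (r : σ → ℕ → Bool) (n : ℕ) :
    enumUpTo r n <+: enumUpTo r (n + 1) := by
  rw [enumUpTo]
  cases (Encodable.decode n : Option (σ × ℕ)) with
  | none => exact List.prefix_rfl
  | some t =>
    dsimp only
    split_ifs
    · exact List.prefix_append _ _
    · exact List.prefix_rfl

theorem enumUpTo_prefix (r : σ → ℕ → Bool) {m n : ℕ} (h : m ≤ n) :
    enumUpTo r m <+: enumUpTo r n := by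
  induction n, h using Nat.le_induction with
  | base => exact List.prefix_rfl
  | succ n _ ih => exact ih.trans (enumUpTo_succ_prefix r n)

theorem enumUpTo_nodup (r : σ → ℕ → Bool) (n : ℕ) : (enumUpTo r n).Nodup := by
  induction n with
  | zero => simp [enumUpTo]
  | succ n ih =>
    rw [enumUpTo]
    cases (Encodable.decode n : Option (σ × ℕ)) with
    | none => exact ih
    | some t =>
      dsimp only
      split_ifs with h
      · exact List.nodup_append.2
          ⟨ih, by simp, by simpa using fun a ha => ne_of_mem_of_not_mem ha h.2⟩
      · exact ih

theorem exists_of_mem_enumUpTo {r : σ → ℕ → Bool} {n : ℕ} {x : σ} (hx : x ∈ enumUpTo r n) :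
    ∃ s, r x s = true := by
  induction n with
  | zero => simp [enumUpTo] at hx
  | succ n ih =>
    rw [enumUpTo] at hx
    revert hx
    cases (Encodable.decode n : Option (σ × ℕ)) with
    | none => exact ih
    | some t =>
      dsimp only
      split_ifs with h
      · intro hx
        rcases List.mem_append.1 hx with hx | hx
        · exact ih hx
        · rw [List.mem_singleton.1 hx]
          exact ⟨_, h.1⟩
      · exact ih

theorem exists_mem_enumUpTo {r : σ → ℕ → Bool} {x : σ} {s : ℕ} (h : r x s = true) :
    ∃ n, x ∈ enumUpTo r n := by
  refine ⟨Encodable.encode (x, s) + 1, ?_⟩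
  rw [enumUpTo, Encodable.encodek]
  dsimp only
  split_ifs with h'
  · simp
  · by_contra hx
    exact h' ⟨h, hx⟩

theorem primrec_enumUpTo {α : Type*} [Primcodable α] {q : α × σ → ℕ → Bool} (hq : Primrec₂ q) :
    Primrec fun t : α × ℕ => enumUpTo (fun x s => q (t.1, x) s) t.2 := by
  have h1 : Primrec₂ fun (t : α × ℕ) (p : ℕ × List σ) =>
      ((Encodable.decode p.1 : Option (σ × ℕ))).casesOn (motive := fun _ => List σ) p.2 fun y =>
        if q (t.1, y.1) y.2 = true ∧ y.1 ∉ p.2 then p.2 ++ [y.1] else p.2 := by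
    refine Primrec.option_casesOn (Primrec.decode.comp (by fun_prop)) (by fun_prop) ?_
    refine Primrec.ite (PrimrecPred.and (Primrec.eq.comp ?_ (Primrec.const _))
      (PrimrecPred.not (PrimrecRel.mem_list.comp (by fun_prop) (by fun_prop)))) ?_ (by fun_prop)
    · refine Primrec₂.comp hq ?_ ?_ <;> fun_prop
    · refine Primrec.list_concat.comp ?_ ?_ <;> fun_prop
  refine (Primrec.nat_rec' (f := fun t : α × ℕ => t.2) (g := fun _ => ([] : List σ))
    Primrec.snd (Primrec.const _) h1).of_eq fun t => ?_
  rcases t with ⟨a, n⟩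
  dsimp only
  induction n with
  | zero => rfl
  | succ n ih => rw [enumUpTo, ← ih]

end Enumeration

theorem Semidec.exists_partrec {α σ : Type*} [Primcodable α] [Primcodable σ]
    {R : α → σ → Prop} (hR : Semidec fun t : α × σ => R t.1 t.2)
    (huniq : ∀ a x y, R a x → R a y → x = y) :
    ∃ f : α →. σ, Partrec f ∧ ∀ a x, x ∈ f a ↔ R a x := by
  obtain ⟨q, h1, -, h3⟩ := hR
  let g : α → ℕ → Option σ := fun a n => (Encodable.decode n : Option (σ × ℕ)).bind fun t =>
    if q (a, t.1) t.2 = true then some t.1 else none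
  have hg : ∀ a n x, x ∈ g a n → R a x := by
    intro a n x hx
    simp only [g, Option.mem_def, Option.bind_eq_some_iff, Option.ite_none_right_eq_some,
      Option.some.injEq] at hx
    obtain ⟨t, -, ht, rfl⟩ := hx
    exact (h3 (a, t.1)).2 ⟨_, ht⟩
  refine ⟨fun a => Nat.rfindOpt (g a), Partrec.rfindOpt (Primrec₂.to_comp ?_), ?_⟩
  · refine Primrec.option_bind (Primrec.decode.comp (by fun_prop)) ?_
    refine Primrec.ite (Primrec.eq.comp ?_ (Primrec.const _))
      (Primrec.option_some.comp (by fun_prop)) (Primrec.const _)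
    refine Primrec₂.comp h1 ?_ ?_ <;> fun_prop
  · intro a x
    constructor
    · intro h
      obtain ⟨n, hn⟩ := Nat.rfindOpt_spec h
      exact hg _ _ _ hn
    · intro h
      obtain ⟨s, hs⟩ := (h3 (a, x)).1 h
      have hd : (Nat.rfindOpt (g a)).Dom := by
        refine Nat.rfindOpt_dom.2 ⟨Encodable.encode (x, s), x, ?_⟩
        simp only [g, Encodable.encodek]
        simpa using hs
      obtain ⟨n, hn⟩ := Nat.rfindOpt_spec (Part.get_mem hd)
      rw [huniq a x _ h (hg _ _ _ hn)]
      exact Part.get_mem hd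

/-! ### Encodings of strings -/

theorem eBits_nil : eBits [] = [true, false] := rfl

theorem eBits_cons (b : Bool) (x : List Bool) : eBits (b :: x) = b :: b :: eBits x := rfl

theorem eBits_append_inj {x x' y y' : List Bool} (h : eBits x ++ y = eBits x' ++ y') :
    x = x' ∧ y = y' := by
  induction x generalizing x' with
  | nil =>
    cases x' with
    | nil => simpa [eBits_nil] using h
    | cons b x' => cases b <;> simp [eBits_nil, eBits_cons] at h
  | cons b x ih =>
    cases x' with
    | nil => cases b <;> simp [eBits_nil, eBits_cons] at h
    | cons b' x' =>
      simp only [eBits_cons, List.cons_append, List.cons.injEq] at h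
      obtain ⟨rfl, -, h⟩ := h
      obtain ⟨rfl, rfl⟩ := ih h
      exact ⟨rfl, rfl⟩

theorem length_eBits (x : List Bool) : (eBits x).length = 2 * x.length + 2 := by
  induction x with
  | nil => rfl
  | cons b x ih => simp only [eBits_cons, List.length_cons, ih]; ring

theorem ePair_inj {x x' y y' : List Bool} (h : ePair x y = ePair x' y') : x = x' ∧ y = y' :=
  eBits_append_inj h

theorem eList_injective : Function.Injective eList := by
  intro l l' h
  induction l generalizing l' with
  | nil =>
    cases l' with
    | nil => rfl
    | cons a l' =>
      have := congrArg List.length h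
      simp [eList, length_eBits] at this
      omega
  | cons a l ih =>
    cases l' with
    | nil =>
      have := congrArg List.length h
      simp [eList, length_eBits] at this
    | cons a' l' =>
      have h' : eBits a ++ eList l = eBits a' ++ eList l' := by simpa [eList] using h
      obtain ⟨rfl, h2⟩ := eBits_append_inj h'
      rw [ih h2]

/-- Encoding of a rectangle given by the list of its sides. -/
def encSides (L : List (List (List Bool))) : List Bool := eList (L.map eList)

theorem encSides_injective : Function.Injective encSides := fun _ _ h =>
  List.map_injective_iff.2 eList_injective (eList_injective h)

theorem encRectL_eq {ℓ : ℕ} (R : Fin ℓ → List (List Bool)) :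
    encRectL R = encSides ((List.finRange ℓ).map R) := by
  simp [encRectL, encSides, Function.comp_def]

theorem primrec_eBits : Primrec eBits := by
  refine Primrec.append_apply (Primrec.list_flatten.comp (Primrec.list_map Primrec.id ?_))
    (Primrec.const _)
  refine Primrec.list_cons.comp (by fun_prop) (Primrec.list_cons.comp (by fun_prop) (by fun_prop))

theorem primrec_ePair_apply {α : Type*} [Primcodable α] {f g : α → List Bool} (hf : Primrec f)
    (hg : Primrec g) : Primrec fun a => ePair (f a) (g a) :=
  (primrec_eBits.comp hf).append_apply hg

theorem primrec_eList : Primrec eList :=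
  Primrec.list_flatten.comp (Primrec.list_map Primrec.id
    (primrec_eBits.comp (Primrec.snd (α := List (List Bool)))))

theorem primrec_encSides : Primrec encSides :=
  primrec_eList.comp (Primrec.list_map Primrec.id (primrec_eList.comp Primrec.snd))

theorem primrec_encSides_apply {α : Type*} [Primcodable α] {f : α → List (List (List Bool))}
    (hf : Primrec f) : Primrec fun a => encSides (f a) :=
  primrec_encSides.comp hf

attribute [fun_prop] primrec_ePair_apply primrec_encSides_apply

/-- The number with a given binary expansion, least significant bit first. -/
def bitsVal (l : List Bool) : ℕ := l.foldr (fun b v => 2 * v + cond b 1 0) 0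

theorem exists_bitsVal (j n : ℕ) (h : n < 2 ^ j) :
    ∃ l : List Bool, l.length = j ∧ bitsVal l = n := by
  induction j generalizing n with
  | zero => exact ⟨[], rfl, by simp [bitsVal]; omega⟩
  | succ j ih =>
    obtain ⟨l, hl, hv⟩ := ih (n / 2) (by rw [pow_succ] at h; omega)
    refine ⟨decide (n % 2 = 1) :: l, by simp [hl], ?_⟩
    simp only [bitsVal, List.foldr_cons] at hv ⊢
    rw [hv]
    rcases Nat.mod_two_eq_zero_or_one n with h2 | h2 <;> simp [h2] <;> omega

theorem primrec_bitsVal : Primrec bitsVal := by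
  refine Primrec.list_foldr (α := List Bool) (β := Bool) (σ := ℕ)
    (h := fun _ t => 2 * t.2 + cond t.1 1 0) Primrec.id (Primrec.const 0) ?_
  refine Primrec.nat_add.comp (Primrec.nat_mul.comp (Primrec.const 2) (by fun_prop)) ?_
  exact Primrec.cond (by fun_prop) (Primrec.const _) (Primrec.const _)

/-! ### Bounds on Kolmogorov complexity -/

theorem KC_le_of_mem {U : Machine} {p u x : List Bool} (h : x ∈ U p u) : KC U x u ≤ p.length :=
  Nat.sInf_le ⟨p, rfl, h⟩

/-- `x` has a program of length at most `k` on the condition `u`. -/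
def HasProg (U : Machine) (x u : List Bool) (k : ℕ) : Prop := ∃ p, p.length ≤ k ∧ x ∈ U p u

theorem IsUniversal.exists_KC_le_length {U : Machine} (hU : IsUniversal U) :
    ∃ c, ∀ x u, HasProg U x u (KC U x u) ∧ KC U x u ≤ x.length + c := by
  obtain ⟨c, hc⟩ := hU.2 (fun p _ => Part.some p) (Computable.fst (α := List Bool) (β := List Bool))
  refine ⟨c, fun x u => ?_⟩
  obtain ⟨q, hq, hl⟩ := hc x u x (Part.mem_some _)
  refine ⟨?_, (KC_le_of_mem hq).trans hl⟩
  obtain ⟨p, hp, hx⟩ := Nat.sInf_mem (s := { k | ∃ p : List Bool, p.length = k ∧ x ∈ U p u })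
    ⟨_, q, rfl, hq⟩
  exact ⟨p, hp.le, hx⟩

/-- An element of a semidecidable set with at most `2 ^ j` elements can be described by the
parameters of the set and `j` further bits. -/
theorem IsUniversal.exists_KC_le {U : Machine} (hU : IsUniversal U) {β : Type*} [Primcodable β]
    {S : List Bool → β → List Bool → Prop}
    (hS : Semidec fun t : (List Bool × β) × List Bool => S t.1.1 t.1.2 t.2) :
    ∃ c, ∀ u m x j, S u m x → ∀ F : Finset (List Bool), (∀ y, S u m y → y ∈ F) →
      F.card ≤ 2 ^ j → KC U x u ≤ j + 2 * Nat.size (Encodable.encode m) + c := by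
  obtain ⟨q, h1, -, h3⟩ := hS
  let e : List Bool × β → ℕ → List (List Bool) := fun a => enumUpTo fun x s => q (a, x) s
  let R : List Bool × List Bool → List Bool → Prop := fun a x =>
    ∃ t : (List Bool × List Bool) × β × ℕ,
    a.1 = ePair t.1.1 t.1.2 ∧ (Encodable.decode (bitsVal t.1.1) : Option β) = some t.2.1 ∧
      (e (a.2, t.2.1) t.2.2)[bitsVal t.1.2]? = some x
  have hR : Semidec fun t : (List Bool × List Bool) × List Bool => R t.1 t.2 := by
    refine Semidec.ex ((Semidec.eq (by fun_prop) (by fun_prop)).and ((Semidec.eq ?_ ?_).and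
      (Semidec.eq ?_ ?_)))
    · exact Primrec.decode.comp (primrec_bitsVal.comp (by fun_prop))
    · exact Primrec.option_some.comp (by fun_prop)
    · refine Primrec.list_getElem?.comp ((primrec_enumUpTo h1).comp (g := fun t :
        ((List Bool × List Bool) × List Bool) × (List Bool × List Bool) × β × ℕ =>
          ((t.1.1.2, t.2.2.1), t.2.2.2)) ?_) (primrec_bitsVal.comp ?_) <;> fun_prop
    · exact Primrec.option_some.comp (by fun_prop)
  obtain ⟨V, hV, hVR⟩ := hR.exists_partrec (by
    rintro ⟨p, u⟩ x y ⟨⟨⟨w, z⟩, m, n⟩, h, hm, hx⟩ ⟨⟨⟨w', z'⟩, m', n'⟩, h', hm', hy⟩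
    obtain ⟨rfl, rfl⟩ := ePair_inj (h.symm.trans h')
    obtain rfl : m = m' := by simpa using hm.symm.trans hm'
    dsimp only at hx hy
    have hmono : ∀ {n n'}, n ≤ n' → ∀ v, (e (u, m) n)[bitsVal z]? = some v →
        (e (u, m) n')[bitsVal z]? = some v := fun hn v hv => by
      obtain ⟨hlt, rfl⟩ := List.getElem?_eq_some_iff.1 hv
      rw [List.getElem?_eq_some_iff]
      have hp := enumUpTo_prefix (fun x s => q ((u, m), x) s) hn
      exact ⟨hlt.trans_le hp.length_le, (hp.getElem hlt).symm⟩
    have := (hmono (le_max_left n n') _ hx).symm.trans (hmono (le_max_right n n') _ hy)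
    simpa using this)
  obtain ⟨c, hc⟩ := hU.2 (fun p u => V (p, u)) hV
  refine ⟨c + 2, fun u m x j hx F hF hcard => ?_⟩
  obtain ⟨s, hs⟩ := (h3 ((u, m), x)).1 hx
  obtain ⟨n, hn⟩ := exists_mem_enumUpTo (r := fun x s => q ((u, m), x) s) hs
  obtain ⟨i, hi, hix⟩ := List.getElem_of_mem hn
  have hlen : (e (u, m) n).length ≤ 2 ^ j := by
    rw [← List.toFinset_card_of_nodup (enumUpTo_nodup _ n)]
    refine (Finset.card_le_card fun y hy => hF y ?_).trans hcard
    exact (h3 ((u, m), y)).2 (exists_of_mem_enumUpTo (r := fun x s => q ((u, m), x) s)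
      (List.mem_toFinset.1 hy))
  obtain ⟨z, hz, hzi⟩ := exists_bitsVal j i (hi.trans_le hlen)
  obtain ⟨w, hw, hwm⟩ := exists_bitsVal _ _ (Nat.lt_size_self (Encodable.encode m))
  obtain ⟨p, hp, hpl⟩ := hc (ePair w z) u x ((hVR _ _).2 ⟨⟨⟨w, z⟩, m, n⟩, rfl, by
    simp only [hwm, Encodable.encodek], by
    simp only [hzi, e, List.getElem?_eq_some_iff]; exact ⟨hi, hix⟩⟩)
  refine (KC_le_of_mem hp).trans (hpl.trans ?_)
  simp only [ePair, List.length_append, length_eBits, hz, hw]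
  omega

/-! ### Semidecidable predicates attached to a protocol -/

theorem primrec_sections {α : Type*} [Primcodable α] :
    Primrec (List.sections : List (List α) → List (List α)) := by
  have h : Primrec fun L : List (List α) =>
      L.foldr (fun l S => S.flatMap fun s => l.map fun a => a :: s) [[]] := by
    refine Primrec.list_foldr (α := List (List α)) (β := List α) (σ := List (List α))
      (h := fun _ t => t.2.flatMap fun s => t.1.map fun a => a :: s)
      Primrec.id (Primrec.const _) ?_
    refine Primrec.list_flatMap (by fun_prop) ?_
    refine Primrec.list_map (by fun_prop) ?_
    refine Primrec.list_cons.comp ?_ ?_ <;> fun_prop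
  refine h.of_eq fun L => ?_
  induction L with
  | nil => rfl
  | cons l L ih => rw [List.foldr_cons, ih, List.sections]

theorem primrec_sections_apply {α β : Type*} [Primcodable α] [Primcodable β]
    {f : α → List (List β)} (hf : Primrec f) : Primrec fun a => (f a).sections :=
  primrec_sections.comp hf

attribute [fun_prop] primrec_sections_apply

/-- `u` encodes a protocol with the list of transcripts `T`. -/
def IsProtocolCode (u : List Bool) (T : List (List (List (List Bool)))) : Prop :=
  ∃ v, u = ePair v (eList (T.map encSides))

/-- `L` is a transcript of the protocol encoded by `u`. -/
def IsTranscript (u : List Bool) (L : List (List (List Bool))) : Prop :=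
  ∃ T, IsProtocolCode u T ∧ L ∈ T

/-- `x` belongs to the `i`-th side of the transcript `L`, where `L` has complexity at most `k` and
`x` has complexity at most `a` given `L`. -/
def Edge (U : Machine) (u : List Bool) (k a i : ℕ) (x : List Bool) (L : List (List (List Bool))) :
    Prop :=
  IsTranscript u L ∧ x ∈ L.getD i [] ∧ HasProg U (encSides L) u k ∧
    HasProg U x (ePair (encSides L) u) a

/-- `x` has at least `2 ^ e` edges. -/
def Heavy (U : Machine) (u : List Bool) (k a i e : ℕ) (x : List Bool) : Prop :=
  ∃ F : List (List (List (List Bool))), F.Nodup ∧ 2 ^ e ≤ F.length ∧ ∀ L ∈ F, Edge U u k a i x L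

/-- All cells of `L` belong to at most `2 ^ r` distinct transcripts. -/
def Thin (u : List Bool) (r : ℕ) (L : List (List (List Bool))) : Prop :=
  ∃ T, IsProtocolCode u T ∧ ∃ C : List (List (List (List Bool))), (∀ R ∈ T, R ∈ C) ∧
    ∀ z ∈ L.sections, (C.filter fun R => z ∈ R.sections).length ≤ 2 ^ r

/-- `L` is a thin transcript such that, for every entry `(i, a, e, b)` of `Q`, at least `2 ^ b`
elements of the `i`-th side of `L` are heavy. -/
def Rich (U : Machine) (u : List Bool) (k r : ℕ) (Q : List (ℕ × ℕ × ℕ × ℕ))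
    (L : List (List (List Bool))) : Prop :=
  IsTranscript u L ∧ Thin u r L ∧ ∀ t ∈ Q, ∃ F : List (List Bool), F.Nodup ∧
    2 ^ t.2.2.2 ≤ F.length ∧ ∀ x ∈ F, x ∈ L.getD t.1 [] ∧ Heavy U u k t.2.1 t.1 t.2.2.1 x

/-- The function `g` takes the value `v` on the rectangle `L`. -/
def HasValue (g : List (List Bool) → List Bool) (L : List (List (List Bool))) (v : List Bool) :
    Prop :=
  ∃ y, y ∈ L.sections ∧ g y = v

section SemidecPredicates

variable {α : Type*} [Primcodable α] {U : Machine} {u v x : α → List Bool}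
  {L : α → List (List (List Bool))} {k a i e r : α → ℕ}

theorem semidec_hasProg (hU : Partrec₂ U) (hx : Primrec x) (hu : Primrec u) (hk : Primrec k) :
    Semidec fun t => HasProg U (x t) (u t) (k t) := by
  refine Semidec.ex ((Semidec.le (by fun_prop) (by fun_prop)).and ?_)
  exact (Semidec.of_partrec hU).comp (f := fun t : α × List Bool => ((t.2, u t.1), x t.1))
    (by fun_prop)

theorem semidec_isProtocolCode {T : α → List (List (List (List Bool)))} (hu : Primrec u)
    (hT : Primrec T) : Semidec fun t => IsProtocolCode (u t) (T t) := by
  refine Semidec.ex (Semidec.eq (by fun_prop) (primrec_ePair_apply (by fun_prop)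
    (primrec_eList.comp (Primrec.list_map (by fun_prop) (primrec_encSides_apply (by fun_prop))))))

theorem semidec_isTranscript (hu : Primrec u) (hL : Primrec L) :
    Semidec fun t => IsTranscript (u t) (L t) :=
  Semidec.ex ((semidec_isProtocolCode (by fun_prop) (by fun_prop)).and
    (Semidec.mem (by fun_prop) (by fun_prop)))

theorem semidec_edge (hU : Partrec₂ U) (hu : Primrec u) (hk : Primrec k) (ha : Primrec a)
    (hi : Primrec i) (hx : Primrec x) (hL : Primrec L) :
    Semidec fun t => Edge U (u t) (k t) (a t) (i t) (x t) (L t) :=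
  (semidec_isTranscript hu hL).and ((Semidec.mem hx (by fun_prop)).and
    ((semidec_hasProg hU (by fun_prop) (by fun_prop) (by fun_prop)).and
      (semidec_hasProg hU (by fun_prop) (by fun_prop) (by fun_prop))))

theorem semidec_heavy (hU : Partrec₂ U) (hu : Primrec u) (hk : Primrec k) (ha : Primrec a)
    (hi : Primrec i) (he : Primrec e) (hx : Primrec x) :
    Semidec fun t => Heavy U (u t) (k t) (a t) (i t) (e t) (x t) :=
  Semidec.ex ((Semidec.nodup (by fun_prop)).and ((Semidec.le (by fun_prop) (by fun_prop)).and
    (Semidec.forall_mem (semidec_edge hU (by fun_prop) (by fun_prop) (by fun_prop) (by fun_prop)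
      (by fun_prop) (by fun_prop)) (by fun_prop))))

theorem semidec_thin (hu : Primrec u) (hr : Primrec r) (hL : Primrec L) :
    Semidec fun t => Thin (u t) (r t) (L t) := by
  have hsub : Semidec fun t : (α × List (List (List (List Bool)))) ×
      List (List (List (List Bool))) => ∀ R ∈ t.1.2, R ∈ t.2 :=
    Semidec.forall_mem (p := fun (t : (α × List (List (List (List Bool)))) ×
      List (List (List (List Bool)))) R => R ∈ t.2)
      (Semidec.mem (by fun_prop) (by fun_prop)) (by fun_prop)
  refine Semidec.ex ((semidec_isProtocolCode (by fun_prop) (by fun_prop)).and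
    (Semidec.ex (hsub.and
      (Semidec.forall_mem (Semidec.le (Primrec.length_apply ?_) (by fun_prop)) (by fun_prop)))))
  have h : PrimrecRel fun (R : List (List (List Bool))) (z : List (List Bool)) =>
      z ∈ R.sections := PrimrecRel.mem_list.comp (by fun_prop) (by fun_prop)
  refine h.listFilter.comp ?_ ?_ <;> fun_prop

theorem semidec_rich {Q : α → List (ℕ × ℕ × ℕ × ℕ)} (hU : Partrec₂ U) (hu : Primrec u)
    (hk : Primrec k) (hr : Primrec r) (hQ : Primrec Q) (hL : Primrec L) :
    Semidec fun t => Rich U (u t) (k t) (r t) (Q t) (L t) := by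
  refine (semidec_isTranscript hu hL).and ((semidec_thin hu hr hL).and
    (Semidec.forall_mem (Semidec.ex ((Semidec.nodup (by fun_prop)).and
      ((Semidec.le (by fun_prop) (by fun_prop)).and (Semidec.forall_mem
        ((Semidec.mem ?_ ?_).and (semidec_heavy hU ?_ ?_ ?_ ?_ ?_ ?_)) (by fun_prop))))) hQ)) <;>
  fun_prop

theorem semidec_hasValue {g : List (List Bool) → List Bool} (hg : Computable g) (hL : Primrec L)
    (hv : Primrec v) : Semidec fun t => HasValue g (L t) (v t) := by
  refine Semidec.ex ((Semidec.mem (by fun_prop) (by fun_prop)).and ?_)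
  refine ((Semidec.of_partrec hg.partrec).comp (f := fun t : α × List (List Bool) => (t.2, v t.1))
    (by fun_prop)).of_eq fun t => ?_
  simp [eq_comm]

end SemidecPredicates

section ComplexityBounds

variable {U : Machine}

theorem exists_KC_transcript_le (hU : IsUniversal U) :
    ∃ c, ∀ u L j, IsTranscript u L → ∀ F : Finset (List (List (List Bool))),
      (∀ L', IsTranscript u L' → L' ∈ F) → F.card ≤ 2 ^ j → KC U (encSides L) u ≤ j + c := by
  obtain ⟨c, hc⟩ := hU.exists_KC_le (β := Unit)
    (S := fun u _ τ => ∃ L, τ = encSides L ∧ IsTranscript u L)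
    (Semidec.ex ((Semidec.eq (by fun_prop) (by fun_prop)).and
      (semidec_isTranscript (by fun_prop) (by fun_prop))))
  refine ⟨c, fun u L j hL F hF hj => ?_⟩
  refine (hc u () _ j ⟨L, rfl, hL⟩ (F.image encSides) ?_ (Finset.card_image_le.trans hj)).trans ?_
  · rintro _ ⟨L', rfl, hL'⟩
    exact Finset.mem_image_of_mem _ (hF _ hL')
  · simp

theorem exists_KC_rich_le (hU : IsUniversal U) :
    ∃ c, ∀ u k r Q L j, Rich U u k r Q L → ∀ F : Finset (List (List (List Bool))),
      (∀ L', Rich U u k r Q L' → L' ∈ F) → F.card ≤ 2 ^ j →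
      KC U (encSides L) u ≤ j + 2 * Nat.size (Encodable.encode (k, r, Q)) + c := by
  obtain ⟨c, hc⟩ := hU.exists_KC_le (β := ℕ × ℕ × List (ℕ × ℕ × ℕ × ℕ))
    (S := fun u m τ => ∃ L, τ = encSides L ∧ Rich U u m.1 m.2.1 m.2.2 L)
    (Semidec.ex ((Semidec.eq (by fun_prop) (by fun_prop)).and
      (semidec_rich hU.1 (by fun_prop) (by fun_prop) (by fun_prop) (by fun_prop) (by fun_prop))))
  refine ⟨c, fun u k r Q L j hL F hF hj => ?_⟩
  refine hc u (k, r, Q) _ j ⟨L, rfl, hL⟩ (F.image encSides) ?_ (Finset.card_image_le.trans hj)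
  rintro _ ⟨L', rfl, hL'⟩
  exact Finset.mem_image_of_mem _ (hF _ hL')

theorem exists_KC_heavy_le (hU : IsUniversal U) :
    ∃ c, ∀ u k a i e x L j, x ∈ L.getD i [] → Heavy U u k a i e x → ∀ F : Finset (List Bool),
      (∀ x' ∈ L.getD i [], Heavy U u k a i e x' → x' ∈ F) → F.card ≤ 2 ^ j →
      KC U x (ePair (encSides L) u) ≤ j + 2 * Nat.size (Encodable.encode (k, a, i, e)) + c := by
  obtain ⟨c, hc⟩ := hU.exists_KC_le (β := ℕ × ℕ × ℕ × ℕ)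
    (S := fun v m x => ∃ t : List (List (List Bool)) × List Bool, v = ePair (encSides t.1) t.2 ∧
      x ∈ t.1.getD m.2.2.1 [] ∧ Heavy U t.2 m.1 m.2.1 m.2.2.1 m.2.2.2 x)
    (Semidec.ex ((Semidec.eq (by fun_prop) (by fun_prop)).and
      ((Semidec.mem (by fun_prop) (by fun_prop)).and
      (semidec_heavy hU.1 (by fun_prop) (by fun_prop) (by fun_prop) (by fun_prop) (by fun_prop)
        (by fun_prop)))))
  refine ⟨c, fun u k a i e x L j hx hh F hF hj => ?_⟩
  refine hc _ (k, a, i, e) x j ⟨(L, u), rfl, hx, hh⟩ F ?_ hj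
  rintro x' ⟨⟨L', u'⟩, h, hx', hh'⟩
  obtain ⟨h1, rfl⟩ := ePair_inj h
  obtain rfl := encSides_injective h1
  exact hF _ hx' hh'

theorem exists_KC_edge_le (hU : IsUniversal U) {g : List (List Bool) → List Bool}
    (hg : Computable g) :
    ∃ c, ∀ u k a i x v L j, Edge U u k a i x L → HasValue g L v →
      ∀ F : Finset (List (List (List Bool))),
      (∀ L', Edge U u k a i x L' → HasValue g L' v → L' ∈ F) → F.card ≤ 2 ^ j →
      KC U (encSides L) (ePair x (ePair v u)) ≤
        j + 2 * Nat.size (Encodable.encode (k, a, i)) + c := by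
  obtain ⟨c, hc⟩ := hU.exists_KC_le (β := ℕ × ℕ × ℕ)
    (S := fun w m τ => ∃ t : List Bool × List Bool × List Bool,
      w = ePair t.1 (ePair t.2.1 t.2.2) ∧ ∃ L, τ = encSides L ∧
        Edge U t.2.2 m.1 m.2.1 m.2.2 t.1 L ∧ HasValue g L t.2.1)
    (Semidec.ex ((Semidec.eq (by fun_prop) (by fun_prop)).and (Semidec.ex
      ((Semidec.eq (by fun_prop) (by fun_prop)).and ((semidec_edge hU.1 (by fun_prop)
        (by fun_prop) (by fun_prop) (by fun_prop) (by fun_prop) (by fun_prop)).and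
          (semidec_hasValue hg (by fun_prop) (by fun_prop)))))))
  refine ⟨c, fun u k a i x v L j hE hv F hF hj => ?_⟩
  refine hc _ (k, a, i) _ j ⟨(x, v, u), rfl, L, rfl, hE, hv⟩ (F.image encSides) ?_
    (Finset.card_image_le.trans hj)
  rintro _ ⟨⟨x', v', u'⟩, h, L', rfl, hE', hv'⟩
  obtain ⟨rfl, h1⟩ := ePair_inj h
  obtain ⟨rfl, rfl⟩ := ePair_inj h1
  exact Finset.mem_image_of_mem _ (hF _ hE' hv')

theorem exists_KC_value_le (hU : IsUniversal U) {g : List (List Bool) → List Bool}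
    (hg : Computable g) :
    ∃ c, ∀ u k a i x h v j,
      (∃ F : List (List (List (List Bool))), F.Nodup ∧ 2 ^ h ≤ F.length ∧
        ∀ L ∈ F, Edge U u k a i x L ∧ HasValue g L v) →
      ∀ G : Finset (List Bool),
      (∀ v', (∃ F : List (List (List (List Bool))), F.Nodup ∧ 2 ^ h ≤ F.length ∧
        ∀ L ∈ F, Edge U u k a i x L ∧ HasValue g L v') → v' ∈ G) → G.card ≤ 2 ^ j →
      KC U v (ePair x u) ≤ j + 2 * Nat.size (Encodable.encode (k, a, i, h)) + c := by
  obtain ⟨c, hc⟩ := hU.exists_KC_le (β := ℕ × ℕ × ℕ × ℕ)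
    (S := fun w m v => ∃ t : List Bool × List Bool, w = ePair t.1 t.2 ∧
      ∃ F : List (List (List (List Bool))), F.Nodup ∧ 2 ^ m.2.2.2 ≤ F.length ∧
        ∀ L ∈ F, Edge U t.2 m.1 m.2.1 m.2.2.1 t.1 L ∧ HasValue g L v)
    (Semidec.ex ((Semidec.eq (by fun_prop) (by fun_prop)).and (Semidec.ex
      ((Semidec.nodup (by fun_prop)).and ((Semidec.le (by fun_prop) (by fun_prop)).and
      (Semidec.forall_mem ((semidec_edge hU.1 (by fun_prop)
        (by fun_prop) (by fun_prop) (by fun_prop) (by fun_prop) (by fun_prop)).and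
          (semidec_hasValue hg (by fun_prop) (by fun_prop))) (by fun_prop)))))))
  refine ⟨c, fun u k a i x h v j hv G hG hj => ?_⟩
  refine hc _ (k, a, i, h) v j ⟨(x, u), rfl, hv⟩ G ?_ hj
  rintro v' ⟨⟨x', u'⟩, h1, hv'⟩
  obtain ⟨rfl, rfl⟩ := ePair_inj h1
  exact hG _ hv'

end ComplexityBounds

/-! ### Counting -/

theorem exists_nodup_iff {α : Type*} {p : α → Prop} {S : Finset α} (hS : ∀ a, a ∈ S ↔ p a)
    (m : ℕ) : (∃ F : List α, F.Nodup ∧ m ≤ F.length ∧ ∀ a ∈ F, p a) ↔ m ≤ S.card := by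
  classical
  constructor
  · rintro ⟨F, hF, hm, h⟩
    rw [← List.toFinset_card_of_nodup hF] at hm
    exact hm.trans (Finset.card_le_card fun a ha => (hS a).2 (h a (List.mem_toFinset.1 ha)))
  · intro h
    exact ⟨S.toList, S.nodup_toList, by simpa using h, fun a ha => (hS a).1 (by simpa using ha)⟩

theorem mem_allBV (n : ℕ) (s : List Bool) : s ∈ allBV n ↔ s.length = n := by
  induction n generalizing s with
  | zero => simp [allBV]
  | succ n ih => cases s with
    | nil => simp [allBV]
    | cons b s => cases b <;> simp [allBV, ih]

theorem length_allBV (n : ℕ) : (allBV n).length = 2 ^ n := by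
  induction n with
  | zero => rfl
  | succ n ih => simp [allBV, List.length_flatMap, ih, pow_succ]

theorem card_le_of_hasProg {U : Machine} {u : List Bool} {k : ℕ} (F : Finset (List Bool))
    (h : ∀ x ∈ F, HasProg U x u k) : F.card ≤ 2 ^ (k + 1) := by
  choose! p hp hU using h
  have h1 : F.card ≤ ((Finset.range (k + 1)).biUnion fun n => (allBV n).toFinset).card := by
    refine Finset.card_le_card_of_injOn p (fun x hx => ?_) fun x hx y hy hxy => ?_
    · simpa [mem_allBV, Nat.lt_succ_iff] using hp x hx
    · exact Part.mem_unique (hU x hx) (hxy ▸ hU y hy)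
  refine h1.trans (Finset.card_biUnion_le.trans ?_)
  refine (Finset.sum_le_sum fun n _ => (List.toFinset_card_le _).trans (length_allBV n).le).trans ?_
  exact (Nat.geomSum_lt le_rfl fun n hn => Finset.mem_range.1 hn).le

theorem card_mul_le_of_heavy {U : Machine} {u : List Bool} {k a i e : ℕ}
    {T : Finset (List (List (List Bool)))} (hT : ∀ L, L ∈ T ↔ IsTranscript u L)
    (X : Finset (List Bool)) (hX : ∀ x ∈ X, Heavy U u k a i e x) :
    X.card * 2 ^ e ≤ 2 ^ (k + 1) * 2 ^ (a + 1) := by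
  classical
  have h1 : X.card * 2 ^ e ≤ (T.filter fun L => HasProg U (encSides L) u k).card * 2 ^ (a + 1) := by
    refine Finset.card_mul_le_card_mul (fun x L => Edge U u k a i x L) (fun x hx => ?_)
      fun L _ => ?_
    · refine (exists_nodup_iff (fun L => ?_) _).1 (hX x hx)
      simp only [Finset.mem_bipartiteAbove, Finset.mem_filter, hT]
      exact ⟨And.right, fun h => ⟨⟨h.1, h.2.2.1⟩, h⟩⟩
    · refine card_le_of_hasProg (U := U) (u := ePair (encSides L) u) _ fun x hx => ?_
      exact ((Finset.mem_bipartiteBelow _).1 hx).2.2.2.2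
  refine h1.trans (Nat.mul_le_mul_right _ ?_)
  rw [← Finset.card_image_of_injective _ encSides_injective]
  refine card_le_of_hasProg (U := U) (u := u) _ fun x hx => ?_
  obtain ⟨L, hL, rfl⟩ := Finset.mem_image.1 hx
  exact (Finset.mem_filter.1 hL).2

section Sections

variable {β : Type*} {ℓ : ℕ}

theorem exists_map_finRange_of_length {L : List β} (h : L.length = ℓ) :
    ∃ z : Fin ℓ → β, L = (List.finRange ℓ).map z := by
  subst h
  exact ⟨L.get, by simp⟩

theorem getD_map_finRange (R : Fin ℓ → β) (i : Fin ℓ) (d : β) :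
    ((List.finRange ℓ).map R).getD i d = R i := by
  simp [List.getD]

theorem map_finRange_mem_sections {L : List (List β)} (hL : L.length = ℓ) {z : Fin ℓ → β} :
    (List.finRange ℓ).map z ∈ L.sections ↔ ∀ i : Fin ℓ, z i ∈ L.getD i [] := by
  obtain ⟨R, rfl⟩ := exists_map_finRange_of_length hL
  simp only [List.mem_sections, getD_map_finRange, List.forall₂_map_left_iff,
    List.forall₂_map_right_iff, List.forall₂_same]
  simp

theorem length_of_mem_sections {L : List (List β)} {y : List β} (hy : y ∈ L.sections) :
    y.length = L.length := (List.mem_sections.1 hy).length_eq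

end Sections

theorem card_mul_le_of_thin {ℓ r : ℕ} {u : List Bool} {T : Finset (List (List (List Bool)))}
    (hℓ : ∀ L ∈ T, L.length = ℓ) (hT : ∀ L ∈ T, IsTranscript u L) (hr : ∀ L ∈ T, Thin u r L)
    (X : Fin ℓ → Finset (List Bool)) (b : Fin ℓ → ℕ)
    (hb : ∀ L ∈ T, ∀ i, 2 ^ b i ≤ ((X i).filter fun x => x ∈ L.getD i []).card) :
    T.card * ∏ i, 2 ^ b i ≤ (∏ i, (X i).card) * 2 ^ r := by
  classical
  rw [← Fintype.card_piFinset]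
  refine Finset.card_mul_le_card_mul
    (fun L (z : Fin ℓ → List Bool) => ∀ i : Fin ℓ, z i ∈ L.getD i []) (fun L hL => ?_) fun z _ => ?_
  · refine (Finset.prod_le_prod' fun i _ => hb L hL i).trans ?_
    rw [← Fintype.card_piFinset]
    refine Finset.card_le_card fun z hz => ?_
    simp only [Fintype.mem_piFinset, Finset.mem_filter] at hz
    exact (Finset.mem_bipartiteAbove _).2
      ⟨Fintype.mem_piFinset.2 fun i => (hz i).1, fun i => (hz i).2⟩
  · obtain h0 | ⟨L, hL⟩ := (T.bipartiteBelow
      (fun L (z : Fin ℓ → List Bool) => ∀ i : Fin ℓ, z i ∈ L.getD i []) z).eq_empty_or_nonempty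
    · rw [h0]
      exact Nat.zero_le _
    obtain ⟨hL, hz⟩ := (Finset.mem_bipartiteBelow _).1 hL
    obtain ⟨T₁, ⟨v, hv⟩, C, hC, hCr⟩ := hr L hL
    refine le_trans ?_ (hCr _ ((map_finRange_mem_sections (hℓ L hL)).2 hz))
    refine le_trans (Finset.card_le_card fun R hR => ?_) (List.toFinset_card_le _)
    obtain ⟨hR, hzR⟩ := (Finset.mem_bipartiteBelow _).1 hR
    obtain ⟨T₂, ⟨v', hv'⟩, hRT⟩ := hT R hR
    have h2 := eList_injective (ePair_inj (hv.symm.trans hv')).2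
    obtain rfl := List.map_injective_iff.2 encSides_injective h2
    rw [List.mem_toFinset, List.mem_filter, decide_eq_true_eq]
    exact ⟨hC R hRT, (map_finRange_mem_sections (hℓ R hR)).2 hzR⟩

/-! ### Transcripts of a multiparty protocol -/

section Transcripts

variable {ℓ : ℕ} {nn : Fin ℓ → ℕ} (P : MProtocol ℓ nn)

open Classical in
/-- The finite set of all transcripts of a protocol. -/
noncomputable def transcripts : Finset (List (List (List Bool))) :=
  (Fintype.piFinset fun i => (allBV (nn i)).toFinset).image fun x =>
    (List.finRange ℓ).map (P.trans x)

variable {P} {L : List (List (List Bool))}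

theorem mem_transcripts : L ∈ transcripts P ↔
    ∃ x : Fin ℓ → List Bool, (∀ i, (x i).length = nn i) ∧
      L = (List.finRange ℓ).map (P.trans x) := by
  simp [transcripts, mem_allBV, eq_comm]

variable (P) in
theorem card_transcripts_le : (transcripts P).card ≤ 2 ^ ∑ i, nn i := by
  refine Finset.card_image_le.trans ?_
  rw [Fintype.card_piFinset, ← Finset.prod_pow_eq_pow_sum]
  exact Finset.prod_le_prod' fun i _ => (List.toFinset_card_le _).trans (length_allBV _).le

theorem isProtocolCode_encMProt_iff {T : List (List (List (List Bool)))} :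
    IsProtocolCode (encMProt P) T ↔
      T = ((Fintype.piFinset fun i : Fin ℓ => (allBV (nn i)).toFinset).toList).map
        fun x => (List.finRange ℓ).map (P.trans x) := by
  have h : encMProt P = ePair (eList (P.rects.map encRectL)) (eList
      ((((Fintype.piFinset fun i : Fin ℓ => (allBV (nn i)).toFinset).toList).map
        fun x => (List.finRange ℓ).map (P.trans x)).map encSides)) := by
    rw [encMProt, List.map_map]
    simp only [encRectL_eq]
    rfl
  constructor
  · rintro ⟨v, hv⟩
    have h2 := eList_injective (ePair_inj (hv.symm.trans h)).2
    exact List.map_injective_iff.2 encSides_injective h2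
  · rintro rfl
    exact ⟨_, h⟩

theorem isTranscript_encMProt_iff : IsTranscript (encMProt P) L ↔ L ∈ transcripts P := by
  simp [IsTranscript, isProtocolCode_encMProt_iff, transcripts]

theorem length_of_mem_transcripts (h : L ∈ transcripts P) : L.length = ℓ := by
  obtain ⟨x, -, rfl⟩ := mem_transcripts.1 h
  simp

/-- A transcript whose rectangle has thickness at most `2 ^ r` is thin. -/
theorem thin_of_rectThickL_le {r : ℕ} {x : Fin ℓ → List Bool}
    (hr : rectThickL P (P.trans x) ≤ 2 ^ r) :
    Thin (encMProt P) r ((List.finRange ℓ).map (P.trans x)) := by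
  classical
  refine ⟨_, isProtocolCode_encMProt_iff.2 rfl, (transcripts P).toList, fun R hR => ?_,
    fun y hy => ?_⟩
  · simpa [transcripts] using hR
  obtain ⟨z, rfl⟩ := exists_map_finRange_of_length (ℓ := ℓ)
    ((length_of_mem_sections hy).trans (by simp))
  rw [map_finRange_mem_sections (by simp)] at hy
  simp only [getD_map_finRange] at hy
  have hz : cellThickL P z ≤ 2 ^ r := by
    refine le_trans ?_ hr
    exact Finset.le_sup (f := cellThickL P) (by simpa using hy)
  refine le_trans ?_ hz
  rw [cellThickL, List.countP_eq_length_filter,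
    ← List.length_map (f := fun R : Fin ℓ → List (List Bool) => (List.finRange ℓ).map R)]
  refine List.Subperm.length_le (List.subperm_of_subset
    ((Finset.nodup_toList _).filter _) fun R hR => ?_)
  simp only [List.mem_filter, Finset.mem_toList, decide_eq_true_eq] at hR
  obtain ⟨hR, hzR⟩ := hR
  rw [map_finRange_mem_sections (length_of_mem_transcripts hR)] at hzR
  obtain ⟨x', hx', rfl⟩ := mem_transcripts.1 hR
  simp only [getD_map_finRange] at hzR
  exact List.mem_map.2 ⟨_, List.mem_filter.2 ⟨P.trans_mem x' hx', by simpa using hzR⟩, rfl⟩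

theorem thin_of_sum_le {r : ℕ} (hr : ∑ i, nn i ≤ r) : Thin (encMProt P) r L := by
  classical
  refine ⟨_, isProtocolCode_encMProt_iff.2 rfl, (transcripts P).toList, fun R hR => ?_,
    fun y _ => (List.length_filter_le _ _).trans ?_⟩
  · simpa [transcripts] using hR
  · rw [Finset.length_toList]
    exact (card_transcripts_le P).trans (Nat.pow_le_pow_right two_pos hr)

end Transcripts

/-! ### Sizes of parameters -/

theorem size_pair_le {a b s : ℕ} (ha : a.size ≤ s) (hb : b.size ≤ s) :
    (Nat.pair a b).size ≤ 2 * s := by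
  rw [Nat.size_le] at *
  refine (Nat.pair_lt_max_add_one_sq a b).trans_le ?_
  rw [mul_comm, pow_mul]
  exact Nat.pow_le_pow_left (Nat.succ_le_of_lt (max_lt ha hb)) 2

theorem size_succ_le (n : ℕ) : (n + 1).size ≤ n.size + 1 := by
  rw [Nat.size_le, pow_succ]
  have := Nat.lt_size_self n
  omega

theorem size_encode_prod_le {α β : Type*} [Encodable α] [Encodable β] {a : α} {b : β} {s : ℕ}
    (ha : (Encodable.encode a).size ≤ s) (hb : (Encodable.encode b).size ≤ s) :
    (Encodable.encode (a, b)).size ≤ 2 * s := by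
  rw [Encodable.encode_prod_val]
  exact size_pair_le ha hb

theorem size_encode_list_le {α : Type*} [Encodable α] {s : ℕ} (hs : 1 ≤ s) (l : List α)
    (h : ∀ a ∈ l, (Encodable.encode a).size ≤ s) :
    (Encodable.encode l).size ≤ 4 ^ l.length * s := by
  induction l with
  | nil => simp
  | cons a l ih =>
    rw [List.forall_mem_cons] at h
    rw [Encodable.encode_list_cons, List.length_cons, pow_succ]
    have h1 : s ≤ 4 ^ l.length * s := Nat.le_mul_of_pos_left _ (by positivity)
    have h2 := size_pair_le (h.1.trans h1) (ih h.2)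
    have h3 := size_succ_le (Nat.pair (Encodable.encode a) (Encodable.encode l))
    rw [Nat.succ_eq_add_one]
    nlinarith

/-! ### The main inequality -/

theorem exists_KC_value_add_KC_edge_le {U : Machine} (hU : IsUniversal U)
    {g : List (List Bool) → List Bool} (hg : Computable g) :
    ∃ c, ∀ (u : List Bool) (T : Finset (List (List (List Bool)))),
      (∀ L, L ∈ T ↔ IsTranscript u L) →
      (∀ L ∈ T, ∀ v v', HasValue g L v → HasValue g L v' → v = v') →
      ∀ k a i x v L e s, Edge U u k a i x L → HasValue g L v → ¬ Heavy U u k a i (e + 1) x →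
      (Encodable.encode (k, a, i)).size ≤ s →
      (∀ h ≤ e, (Encodable.encode (k, a, i, h)).size ≤ s) →
      KC U v (ePair x u) + KC U (encSides L) (ePair x (ePair v u)) ≤ e + 2 + 4 * s + c := by
  classical
  obtain ⟨c₁, hc₁⟩ := exists_KC_edge_le hU hg
  obtain ⟨c₂, hc₂⟩ := exists_KC_value_le hU hg
  refine ⟨c₁ + c₂, fun u T hT hfun k a i x v L e s hL hv he hs hs' => ?_⟩
  have hE : ∀ v' L', L' ∈ T.filter (fun L => Edge U u k a i x L ∧ HasValue g L v') ↔
      Edge U u k a i x L' ∧ HasValue g L' v' := fun v' L' => by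
    rw [Finset.mem_filter, hT]
    exact ⟨And.right, fun h => ⟨h.1.1, h⟩⟩
  have hEcard : (T.filter fun L => Edge U u k a i x L).card < 2 ^ (e + 1) := by
    by_contra! h
    refine he ((exists_nodup_iff (fun L => ?_) _).2 h)
    rw [Finset.mem_filter, hT]
    exact ⟨And.right, fun h => ⟨h.1, h⟩⟩
  set m := (T.filter fun L => Edge U u k a i x L ∧ HasValue g L v).card
  have hm0 : m ≠ 0 := Finset.card_ne_zero.2 ⟨L, (hE v L).2 ⟨hL, hv⟩⟩
  set h := Nat.log 2 m
  have hhm : 2 ^ h ≤ m := Nat.pow_log_le_self 2 hm0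
  have hmE : m ≤ (T.filter fun L => Edge U u k a i x L).card :=
    Finset.card_le_card (Finset.monotone_filter_right T fun L _ h => h.1)
  have hhe : h ≤ e := Nat.lt_succ_iff.1
    ((Nat.pow_lt_pow_iff_right one_lt_two).1 (hhm.trans_lt (hmE.trans_lt hEcard)))
  have h1 := hc₁ u k a i x v L (h + 1) hL hv _ (fun L' h1 h2 => (hE v L').2 ⟨h1, h2⟩)
    (Nat.lt_pow_succ_log_self one_lt_two m).le
  let G : Finset (List Bool) := (T.biUnion fun L => L.sections.toFinset.image g).filter fun v' =>
    2 ^ h ≤ (T.filter fun L => Edge U u k a i x L ∧ HasValue g L v').card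
  have hG : G.card ≤ 2 ^ (e + 1 - h) := by
    have h2 : G.card * 2 ^ h ≤ (T.filter fun L => Edge U u k a i x L).card * 1 := by
      refine Finset.card_mul_le_card_mul (fun v' L => HasValue g L v') (fun v' hv' => ?_)
        fun L hL => ?_
      · refine (Finset.mem_filter.1 hv').2.trans (Finset.card_le_card fun L hL => ?_)
        rw [Finset.mem_bipartiteAbove]
        rw [Finset.mem_filter] at hL ⊢
        exact ⟨⟨hL.1, hL.2.1⟩, hL.2.2⟩
      · refine Finset.card_le_one.2 fun v₁ h₁ v₂ h₂ => ?_
        exact hfun L (Finset.mem_filter.1 hL).1 _ _ ((Finset.mem_bipartiteBelow _).1 h₁).2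
          ((Finset.mem_bipartiteBelow _).1 h₂).2
    have h3 : e + 1 - h + h = e + 1 := by omega
    refine Nat.le_of_mul_le_mul_right ?_ (Nat.two_pow_pos h)
    rw [← pow_add, h3]
    omega
  have h2 := hc₂ u k a i x h v (e + 1 - h) ((exists_nodup_iff (hE v) _).2 hhm) G
    (fun v' hv' => ?_) hG
  · have := hs' h hhe
    omega
  · have hv'' := (exists_nodup_iff (hE v') _).1 hv'
    refine Finset.mem_filter.2 ⟨?_, hv''⟩
    obtain ⟨F, -, hF, hv'⟩ := hv'
    obtain ⟨L', hL'⟩ := List.exists_mem_of_length_pos ((Nat.two_pow_pos h).trans_le hF)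
    obtain ⟨h3, y, hy, rfl⟩ := hv' L' hL'
    exact Finset.mem_biUnion.2 ⟨L', (hT L').2 h3.1,
      Finset.mem_image_of_mem _ (List.mem_toFinset.2 hy)⟩

/-- Double counting of rich transcripts against tuples of heavy strings. -/
theorem add_sum_le_of_rich {U : Machine} {ℓ : ℕ} {u : List Bool}
    {T : Finset (List (List (List Bool)))} (hT : ∀ L, L ∈ T ↔ IsTranscript u L)
    (hℓ : ∀ L ∈ T, L.length = ℓ) {k r τ : ℕ} {a e b : Fin ℓ → ℕ}
    {T' : Finset (List (List (List Bool)))} (hT' : ∀ L ∈ T',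
      Rich U u k r ((List.finRange ℓ).map fun i : Fin ℓ => ((i : ℕ), a i, e i, b i)) L)
    (hτ : 2 ^ τ ≤ T'.card) :
    τ + ∑ i, b i + ∑ i, e i ≤ r + ∑ i, (k + a i + 2) := by
  classical
  let X : Fin ℓ → Finset (List Bool) := fun i =>
    (T.biUnion fun L => (L.getD i []).toFinset).filter fun x => Heavy U u k (a i) i (e i) x
  have h1 : T'.card * ∏ i, 2 ^ b i ≤ (∏ i, (X i).card) * 2 ^ r := by
    refine card_mul_le_of_thin (u := u) (fun L hL => hℓ L ((hT L).2 (hT' L hL).1))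
      (fun L hL => (hT' L hL).1) (fun L hL => (hT' L hL).2.1) X b fun L hL i => ?_
    obtain ⟨h2, -, h3⟩ := hT' L hL
    refine (exists_nodup_iff (fun x => ?_) _).1
      (h3 ((i : ℕ), a i, e i, b i) (List.mem_map_of_mem (List.mem_finRange i)))
    simp only [X, Finset.mem_filter, Finset.mem_biUnion, List.mem_toFinset]
    exact ⟨fun h => ⟨h.2, h.1.2⟩, fun h => ⟨⟨⟨L, (hT L).2 h2, h.1⟩, h.2⟩, h.1⟩⟩
  have h2 : ∀ i, (X i).card * 2 ^ e i ≤ 2 ^ (k + a i + 2) := fun i => by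
    refine (card_mul_le_of_heavy hT (X i) fun x hx => (Finset.mem_filter.1 hx).2).trans_eq ?_
    rw [← pow_add]
    congr 1
    omega
  rw [← Nat.pow_le_pow_iff_right one_lt_two, pow_add, pow_add, pow_add,
    ← Finset.prod_pow_eq_pow_sum, ← Finset.prod_pow_eq_pow_sum, ← Finset.prod_pow_eq_pow_sum]
  calc 2 ^ τ * (∏ i, 2 ^ b i) * ∏ i, 2 ^ e i
      ≤ T'.card * (∏ i, 2 ^ b i) * ∏ i, 2 ^ e i := by gcongr
    _ ≤ (∏ i, (X i).card) * 2 ^ r * ∏ i, 2 ^ e i := by gcongr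
    _ = 2 ^ r * ∏ i, ((X i).card * 2 ^ e i) := by
        rw [Finset.prod_mul_distrib]
        ring
    _ ≤ 2 ^ r * ∏ i, 2 ^ (k + a i + 2) := by
        gcongr with i
        exact h2 i

theorem log_card_le {α : Type*} {S : Finset α} {n : ℕ} (h : S.card ≤ 2 ^ n) :
    Nat.log 2 S.card ≤ n :=
  (Nat.log_mono_right h).trans (Nat.log_pow one_lt_two n).le

theorem exists_sum_KC_le (ℓ : ℕ) {U : Machine} (hU : IsUniversal U)
    {g : List (List Bool) → List Bool} (hg : Computable g) :
    ∃ c : ℕ, ∀ (nn : Fin ℓ → ℕ) (P : MProtocol ℓ nn),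
      (∀ R ∈ P.rects, ∀ x x' : Fin ℓ → List Bool, (∀ i, x i ∈ R i) → (∀ i, x' i ∈ R i) →
        g ((List.finRange ℓ).map x) = g ((List.finRange ℓ).map x')) →
      ∀ x : Fin ℓ → List Bool, (∀ i, (x i).length = nn i) →
      ∀ r, rectThickL P (P.trans x) ≤ 2 ^ r →
      ∑ i, (KC U (g ((List.finRange ℓ).map x)) (ePair (x i) (encMProt P)) +
        KC U (encRectL (P.trans x))
          (ePair (x i) (ePair (g ((List.finRange ℓ).map x)) (encMProt P)))) +
        KC U (encRectL (P.trans x)) (encMProt P) ≤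
      ℓ * KC U (encRectL (P.trans x)) (encMProt P) + r + c * ((∑ i, nn i + c).size + 1) := by
  classical
  obtain ⟨c₁, hc₁⟩ := hU.exists_KC_le_length
  obtain ⟨c₂, hc₂⟩ := exists_KC_transcript_le hU
  obtain ⟨c₃, hc₃⟩ := exists_KC_rich_le hU
  obtain ⟨c₄, hc₄⟩ := exists_KC_heavy_le hU
  obtain ⟨c₅, hc₅⟩ := exists_KC_value_add_KC_edge_le hU hg
  let C := c₁ + c₂ + c₃ + c₄ + c₅ + ℓ
  let D := 64 * 4 ^ ℓ + C + 1
  refine ⟨C + (4 * ℓ + 2) * D, fun nn P hP x hx r₀ hr₀ => ?_⟩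
  have hN : (∑ i, nn i + C).size ≤ (∑ i, nn i + (C + (4 * ℓ + 2) * D)).size :=
    Nat.size_le_size (by omega)
  set s := (∑ i, nn i + C).size + 1 with hs
  have hs1 : 1 ≤ s := by omega
  have hsize : ∀ m, m ≤ ∑ i, nn i + C → (Encodable.encode m).size ≤ s := fun m hm =>
    (Nat.size_le_size hm).trans (by omega)
  have hsize4 : ∀ k a i h, k ≤ ∑ i, nn i + C → a ≤ ∑ i, nn i + C → i ≤ ∑ i, nn i + C →
      h ≤ ∑ i, nn i + C → (Encodable.encode (k, a, i, h)).size ≤ 8 * s :=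
    fun k a i h hk ha hi hh => by
    have h1 := size_encode_prod_le (hsize i hi) (hsize h hh)
    have h2 := size_encode_prod_le ((hsize a ha).trans (by omega)) h1
    have h3 := size_encode_prod_le ((hsize k hk).trans (by omega)) h2
    omega
  have hsize3 : ∀ k a i, k ≤ ∑ i, nn i + C → a ≤ ∑ i, nn i + C → i ≤ ∑ i, nn i + C →
      (Encodable.encode (k, a, i)).size ≤ 8 * s := fun k a i hk ha hi => by
    have h2 := size_encode_prod_le (hsize a ha) (hsize i hi)
    have h3 := size_encode_prod_le ((hsize k hk).trans (by omega)) h2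
    omega
  set u := encMProt P
  set T := transcripts P
  have hT : ∀ L, L ∈ T ↔ IsTranscript u L := fun L => isTranscript_encMProt_iff.symm
  have hTcard : T.card ≤ 2 ^ ∑ i, nn i := card_transcripts_le P
  rw [encRectL_eq]
  set t := (List.finRange ℓ).map (P.trans x)
  have htT : t ∈ T := mem_transcripts.2 ⟨x, hx, rfl⟩
  have ht : ∀ i : Fin ℓ, t.getD i [] = P.trans x i := fun i => getD_map_finRange _ _ _
  have hxt : ∀ i : Fin ℓ, x i ∈ t.getD i [] := fun i => (ht i).symm ▸ P.trans_contains x hx i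
  set v := g ((List.finRange ℓ).map x)
  have hv : HasValue g t v := ⟨_, (map_finRange_mem_sections (by simp [t])).2 hxt, rfl⟩
  have hfun : ∀ L ∈ T, ∀ v v', HasValue g L v → HasValue g L v' → v = v' := by
    rintro L hL _ _ ⟨y, hy, rfl⟩ ⟨y', hy', rfl⟩
    have hLℓ := length_of_mem_transcripts hL
    obtain ⟨z, rfl⟩ := exists_map_finRange_of_length ((length_of_mem_sections hy).trans hLℓ)
    obtain ⟨z', rfl⟩ := exists_map_finRange_of_length ((length_of_mem_sections hy').trans hLℓ)
    rw [map_finRange_mem_sections hLℓ] at hy hy'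
    obtain ⟨w, hw, rfl⟩ := mem_transcripts.1 hL
    simp only [getD_map_finRange] at hy hy'
    exact hP _ (P.trans_mem w hw) _ _ hy hy'
  set k := KC U (encSides t) u
  let a : Fin ℓ → ℕ := fun i => KC U (x i) (ePair (encSides t) u)
  have hEdge : ∀ i : Fin ℓ, Edge U u k (a i) i (x i) t := fun i =>
    ⟨(hT t).1 htT, hxt i, (hc₁ _ _).1, (hc₁ _ _).1⟩
  let E : Fin ℓ → Finset (List (List (List Bool))) := fun i =>
    T.filter fun L => Edge U u k (a i) i (x i) L
  have hE : ∀ i L, L ∈ E i ↔ Edge U u k (a i) i (x i) L := fun i L => by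
    rw [Finset.mem_filter, hT]
    exact ⟨And.right, fun h => ⟨h.1, h⟩⟩
  let e : Fin ℓ → ℕ := fun i => Nat.log 2 (E i).card
  have hHeavy : ∀ i : Fin ℓ, Heavy U u k (a i) i (e i) (x i) := fun i =>
    (exists_nodup_iff (hE i) _).2
      (Nat.pow_log_le_self 2 (Finset.card_ne_zero.2 ⟨t, (hE i t).2 (hEdge i)⟩))
  have hnHeavy : ∀ i : Fin ℓ, ¬ Heavy U u k (a i) i (e i + 1) (x i) := fun i h =>
    (Nat.lt_pow_succ_log_self one_lt_two _).not_ge ((exists_nodup_iff (hE i) _).1 h)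
  let B : Fin ℓ → Finset (List Bool) := fun i =>
    (t.getD i []).toFinset.filter fun y => Heavy U u k (a i) i (e i) y
  have hB : ∀ i y, y ∈ B i ↔ y ∈ t.getD i [] ∧ Heavy U u k (a i) i (e i) y := fun i y => by
    rw [Finset.mem_filter, List.mem_toFinset]
  let b : Fin ℓ → ℕ := fun i => Nat.log 2 (B i).card
  have hnn : ∀ i, nn i ≤ ∑ i, nn i := fun i => Finset.single_le_sum (by simp) (Finset.mem_univ i)
  have hBcard : ∀ i, (B i).card ≤ 2 ^ nn i := fun i => by
    rw [← length_allBV]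
    refine le_trans (Finset.card_le_card fun y hy => ?_) (List.toFinset_card_le _)
    rw [List.mem_toFinset, mem_allBV]
    exact P.sides_len _ (P.trans_mem x hx) i y (ht i ▸ ((hB i y).1 hy).1)
  let r := min r₀ (∑ i, nn i)
  have hthin : Thin u r t := by
    rcases min_choice r₀ (∑ i, nn i) with h | h
    · exact thin_of_rectThickL_le (hr₀.trans_eq (by rw [← h]))
    · exact thin_of_sum_le h.ge
  have hkN : k ≤ ∑ i, nn i + C := (hc₂ u t _ ((hT t).1 htT) T (fun L => (hT L).2) hTcard).trans
    (by omega)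
  have haN : ∀ i, a i ≤ ∑ i, nn i + C := fun i => by
    have h1 := (hc₁ (x i) (ePair (encSides t) u)).2
    have h2 := hnn i
    rw [hx i] at h1
    simp only [a]
    omega
  have hiN : ∀ i : Fin ℓ, (i : ℕ) ≤ ∑ i, nn i + C := fun i => by omega
  have heN : ∀ i, e i ≤ ∑ i, nn i + C := fun i =>
    (log_card_le ((Finset.card_filter_le _ _).trans hTcard)).trans (by omega)
  have hbN : ∀ i, b i ≤ ∑ i, nn i + C := fun i =>
    (log_card_le (hBcard i)).trans ((hnn i).trans (by omega))
  have hrN : r ≤ ∑ i, nn i + C := (min_le_right _ _).trans (by omega)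
  let Q : List (ℕ × ℕ × ℕ × ℕ) := (List.finRange ℓ).map fun i : Fin ℓ => ((i : ℕ), a i, e i, b i)
  have hsizeQ : (Encodable.encode (k, r, Q)).size ≤ 32 * 4 ^ ℓ * s := by
    have h1 : (Encodable.encode Q).size ≤ 4 ^ ℓ * (8 * s) := by
      refine (size_encode_list_le (s := 8 * s) (by omega) Q fun q hq => ?_).trans_eq (by simp [Q])
      obtain ⟨i, -, rfl⟩ := List.mem_map.1 hq
      exact hsize4 _ _ _ _ (hiN i) (haN i) (heN i) (hbN i)
    have h0 : s ≤ 4 ^ ℓ * (8 * s) :=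
      le_trans (by omega) (Nat.le_mul_of_pos_left (8 * s) (by positivity))
    have h2 := size_encode_prod_le ((hsize r hrN).trans h0) h1
    have h3 := size_encode_prod_le ((hsize k hkN).trans (by omega)) h2
    refine h3.trans_eq (by ring)
  have hRich : Rich U u k r Q t := by
    refine ⟨(hT t).1 htT, hthin, fun q hq => ?_⟩
    obtain ⟨i, -, rfl⟩ := List.mem_map.1 hq
    exact (exists_nodup_iff (hB i) _).2
      (Nat.pow_log_le_self 2 (Finset.card_ne_zero.2 ⟨x i, (hB i _).2 ⟨hxt i, hHeavy i⟩⟩))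
  let T' := T.filter fun L => Rich U u k r Q L
  have hmain := add_sum_le_of_rich (τ := Nat.log 2 T'.card) hT
    (fun L hL => length_of_mem_transcripts hL) (T' := T') (fun L hL => (Finset.mem_filter.1 hL).2)
    (Nat.pow_log_le_self 2 (Finset.card_ne_zero.2 ⟨t, Finset.mem_filter.2 ⟨htT, hRich⟩⟩))
  have hk : k ≤ Nat.log 2 T'.card + 1 + 2 * (32 * 4 ^ ℓ * s) + c₃ :=
    (hc₃ u k r Q t (Nat.log 2 T'.card + 1) hRich T'
      (fun L hL => Finset.mem_filter.2 ⟨(hT L).2 hL.1, hL⟩)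
      (Nat.lt_pow_succ_log_self one_lt_two _).le).trans (by omega)
  have h4 : 1 ≤ 4 ^ ℓ := Nat.one_le_pow _ _ (by norm_num)
  have hCs : C ≤ C * s := Nat.le_mul_of_pos_right _ hs1
  have h4s : s ≤ 4 ^ ℓ * s := Nat.le_mul_of_pos_left _ h4
  have hDs : D * s = 64 * (4 ^ ℓ * s) + C * s + s := by
    simp only [D]
    ring
  have hk' : k ≤ Nat.log 2 T'.card + D * s := by
    rw [mul_assoc] at hk
    omega
  have ha : ∀ i, a i ≤ b i + D * s := fun i => by
    have h1 := hc₄ u k (a i) i (e i) (x i) t (b i + 1) (hxt i) (hHeavy i) (B i)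
      (fun y h h' => (hB i y).2 ⟨h, h'⟩) (Nat.lt_pow_succ_log_self one_lt_two _).le
    have h2 := hsize4 _ _ _ _ hkN (haN i) (hiN i) (heN i)
    simp only [a] at h1 h2 ⊢
    omega
  have hβγ : ∀ i, KC U v (ePair (x i) u) + KC U (encSides t) (ePair (x i) (ePair v u)) ≤
      e i + 2 * (D * s) := fun i => by
    have h1 := hc₅ u T hT hfun k (a i) i (x i) v t (e i) (8 * s) (hEdge i) hv (hnHeavy i)
      (hsize3 _ _ _ hkN (haN i) (hiN i))
      (fun h hh => hsize4 _ _ _ _ hkN (haN i) (hiN i) (hh.trans (heN i)))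
    omega
  have h1 := Finset.sum_le_sum fun i (_ : i ∈ Finset.univ) => ha i
  have h2 := Finset.sum_le_sum fun i (_ : i ∈ Finset.univ) => hβγ i
  simp only [Finset.sum_add_distrib, Finset.sum_const, Finset.card_univ, Fintype.card_fin,
    smul_eq_mul] at h1 h2 hmain ⊢
  have hr : r ≤ r₀ := min_le_left _ _
  have hfin : ((4 * ℓ + 2) * D) * s ≤
      (C + (4 * ℓ + 2) * D) * ((∑ i, nn i + (C + (4 * ℓ + 2) * D)).size + 1) :=
    Nat.mul_le_mul (by omega) (by omega)
  have hD2 : 2 ≤ D * s := by omega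
  have hℓD : ℓ * 2 ≤ ℓ * (D * s) := Nat.mul_le_mul_left _ hD2
  have hexp : ((4 * ℓ + 2) * D) * s = 4 * (ℓ * (D * s)) + 2 * (D * s) := by ring
  have hexp2 : ℓ * (2 * (D * s)) = 2 * (ℓ * (D * s)) := by ring
  omega

theorem size_mul_add_le (ℓ n c : ℕ) :
    (ℓ * n + c).size ≤ (ℓ + c).size + (Nat.log 2 n + 1) := by
  rw [Nat.size_le, pow_add]
  obtain rfl | hn := Nat.eq_zero_or_pos n
  · have := Nat.lt_size_self (ℓ + c)
    simp only [Nat.mul_zero, Nat.log_zero_right]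
    omega
  calc ℓ * n + c ≤ (ℓ + c) * n := by nlinarith
    _ < (ℓ + c + 1) * n := by nlinarith
    _ ≤ 2 ^ (ℓ + c).size * 2 ^ (Nat.log 2 n + 1) :=
        Nat.mul_le_mul (Nat.lt_size_self _) (Nat.lt_pow_succ_log_self one_lt_two n).le

/-- Lower bound on the complexity of the transcript of an `ℓ`-party protocol computing
a computable function `f` of `ℓ` string arguments. -/
theorem stmt16 (ℓ : ℕ) (hℓ : 2 ≤ ℓ) (U : Machine) (hU : IsUniversal U)
    (f : (Fin ℓ → List Bool) → List Bool)
    (hf : ∃ g : List (List Bool) → List Bool, Computable g ∧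
      ∀ x : Fin ℓ → List Bool, f x = g ((List.finRange ℓ).map x)) :
    ∃ d : ℝ, ∀ nn : Fin ℓ → ℕ, ∀ P : MProtocol ℓ nn,
      (∀ R ∈ P.rects, ∀ x x' : Fin ℓ → List Bool,
        (∀ i, x i ∈ R i) → (∀ i, x' i ∈ R i) → f x = f x') →
      ∀ x : Fin ℓ → List Bool, (∀ i, (x i).length = nn i) →
      (KC U (encRectL (P.trans x)) (encMProt P) : ℝ) ≥
        (1 / ((ℓ : ℝ) - 1))
            * ((∑ i : Fin ℓ, (KC U (f x) (ePair (x i) (encMProt P)) : ℝ))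
              + (∑ i : Fin ℓ,
                  (KC U (encRectL (P.trans x)) (ePair (x i) (ePair (f x) (encMProt P))) : ℝ))
              - Real.logb 2 (rectThickL P (P.trans x)))
          - d * Real.logb 2 ((Finset.univ.sup nn : ℕ) : ℝ) - d := by
  obtain ⟨g, hg, hfg⟩ := hf
  obtain ⟨c, hc⟩ := exists_sum_KC_le ℓ hU hg
  refine ⟨c * ((ℓ + c).size + 2) + 1, fun nn P hP x hx => ?_⟩
  have key := hc nn P (fun R hR y y' hy hy' => by rw [← hfg, ← hfg]; exact hP R hR y y' hy hy')
    x hx (Nat.clog 2 (rectThickL P (P.trans x))) (Nat.le_pow_clog one_lt_two _)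
  rw [← hfg] at key
  set n := Finset.univ.sup nn
  have hsum : ∑ i, nn i ≤ ℓ * n := by
    simpa using Finset.sum_le_card_nsmul Finset.univ nn n fun i hi => Finset.le_sup hi
  have hsize : c * ((∑ i, nn i + c).size + 1) ≤ c * ((ℓ + c).size + Nat.log 2 n + 2) :=
    Nat.mul_le_mul_left c (by
      have h1 := Nat.size_le_size (Nat.add_le_add_right hsum c)
      have h2 := size_mul_add_le ℓ n c
      omega)
  have hclog : (Nat.clog 2 (rectThickL P (P.trans x)) : ℝ) ≤
      Real.logb 2 (rectThickL P (P.trans x)) + 1 := by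
    rw [← Real.natCeil_logb_natCast]
    refine (Nat.ceil_lt_add_one ?_).le
    exact div_nonneg (Real.log_natCast_nonneg _) (Real.log_nonneg (by norm_num))
  have hlog : (Nat.log 2 n : ℝ) ≤ Real.logb 2 n := by
    exact_mod_cast Real.natLog_le_logb n 2
  have hlog0 : 0 ≤ Real.logb 2 n := (Nat.cast_nonneg _).trans hlog
  have key' := key.trans (Nat.add_le_add_left hsize _)
  rw [Finset.sum_add_distrib] at key'
  rify at key'
  have hℓ' : (1 : ℝ) ≤ ℓ - 1 := by
    have : (2 : ℝ) ≤ ℓ := by exact_mod_cast hℓ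
    linarith
  set S : ℝ := ((ℓ + c).size : ℝ)
  have hS : 0 ≤ S := Nat.cast_nonneg _
  have hc0 : (0 : ℝ) ≤ c := Nat.cast_nonneg _
  have herr : (c : ℝ) * (S + Nat.log 2 n + 2) + 1 ≤
      (c * (S + 2) + 1) * Real.logb 2 n + (c * (S + 2) + 1) := by
    have h1 := mul_le_mul_of_nonneg_left hlog hc0
    have h2 := mul_nonneg (mul_nonneg hc0 hS) hlog0
    have h3 := mul_nonneg hc0 hlog0
    nlinarith
  have herr0 : 0 ≤ (c * (S + 2) + 1) * Real.logb 2 n + (c * (S + 2) + 1) := by positivity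
  have herr' := le_mul_of_one_le_left herr0 hℓ'
  rw [ge_iff_le, sub_sub, sub_le_iff_le_add, one_div, inv_mul_le_iff₀ (by linarith)]
  linarith
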